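/- arXiv:0706.1792 — 2 statements merged into one kernel-verified Lean document; each statement's English description precedes it below -/
import Mathlib

section
/- Let ι be a type, and let B, M : ι →₀ ℝ be finitely supported functions with 0 ≤ B i ≤ 1 and 0 ≤ M i for all i, and assume there exists i with M i ≠ 0 and B i < 1. Let α := min{(1 − B i)/(M i) : M i > 0, B i < 1}, and let C : ι →₀ ℝ be defined by C i = α·(M i) if B i < 1 and C i = 0 if B i = 1. Define θ(B, M) := card {i : M i ≠ 0 and B i ≠ 1} (a finite set since M has finite support). Then θ(B + C, M + C) < θ(B, M). -/
/-- Step 2 of the main proposition: the invariant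
`θ(B, M) := #{i : M i ≠ 0 and B i ≠ 1}` strictly decreases when passing from `(B, M)` to
`(B + C, M + C)`, where `C` is the truncation divisor built from the threshold `α`. -/
theorem statement2 {ι : Type*} (B M : ι →₀ ℝ)
    (hB0 : ∀ i, 0 ≤ B i) (hB1 : ∀ i, B i ≤ 1) (hM : ∀ i, 0 ≤ M i)
    (hex : ∃ i, M i ≠ 0 ∧ B i < 1)
    (α : ℝ)
    (hα : IsLeast {x : ℝ | ∃ i, 0 < M i ∧ B i < 1 ∧ x = (1 - B i) / M i} α)
    (C : ι →₀ ℝ)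
    (hC : ∀ i, C i = if B i < 1 then α * M i else 0) :
    {i | (M + C) i ≠ 0 ∧ (B + C) i ≠ 1}.ncard < {i | M i ≠ 0 ∧ B i ≠ 1}.ncard := by
  obtain ⟨j, hMj, hBj, hαj⟩ := hα.1
  refine Set.ncard_lt_ncard ?_ (M.support.finite_toSet.subset fun i hi => by simpa using hi.1)
  refine (Set.ssubset_iff_of_subset ?_).2 ⟨j, ⟨hMj.ne', hBj.ne⟩, ?_⟩
  · rintro i ⟨hMC, hBC⟩
    refine ⟨fun h => hMC ?_, fun h => hBC ?_⟩
    · simp [hC, h]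
    · simp [hC, h]
  · rintro ⟨-, hBC⟩
    apply hBC
    rw [Finsupp.add_apply, hC, if_pos hBj, hαj, div_mul_cancel₀ _ hMj.ne']
    ring
end

section
/- Let s, t be positive integers, r_1, …, r_s and r′_1, …, r′_t positive real numbers, m, m′ positive integers, and c ≥ 0 a real number. Let I be a nonempty set and suppose for each i ∈ I we are given integers n_{i,1}, …, n_{i,s} ∈ ℤ with n_{i,j} ≥ −c for all j and with Σ_{j=1}^s r_j n_{i,j} < 0, and nonnegative integers n′_{i,1}, …, n′_{i,t} ∈ ℕ. For each i ∈ I define μ_i > 0 by 1/μ_i := 1 − (m·Σ_{k=1}^t r′_k n′_{i,k})/(m′·Σ_{j=1}^s r_j n_{i,j}). Then 0 < μ_i ≤ 1 for every i ∈ I, and the supremum μ := sup_{i ∈ I} μ_i is attained: there exists l ∈ I with μ_l = μ. -/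
/-- An integer vector bounded below whose positively weighted sum is nonpositive lies in a
finite set. -/
theorem finite_setOf_int_weighted_sum_nonpos {ι : Type*} [Fintype ι] {r : ι → ℝ}
    (hr : ∀ j, 0 < r j) (c : ℝ) :
    {v : ι → ℤ | (∀ j, -c ≤ (v j : ℝ)) ∧ ∑ j, r j * (v j : ℝ) ≤ 0}.Finite := by
  classical
  refine (Set.finite_Icc (fun _ => ⌈-c⌉) fun j => ⌊c * (∑ k, r k) / r j - c⌋).subset ?_
  rintro v ⟨hv, hsum⟩
  refine ⟨fun j => Int.ceil_le.2 (hv j), fun j => Int.le_floor.2 ?_⟩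
  have hle : r j * (v j + c) ≤ ∑ k, r k * (v k + c) :=
    Finset.single_le_sum (f := fun k => r k * (v k + c))
      (fun k _ => mul_nonneg (hr k).le (by linarith [hv k])) (Finset.mem_univ j)
  have hsplit : ∑ k, r k * (v k + c) = ∑ k, r k * (v k : ℝ) + c * ∑ k, r k := by
    simp only [mul_add, Finset.sum_add_distrib, Finset.mul_sum, mul_comm]
  rw [le_sub_iff_add_le, le_div_iff₀ (hr j), mul_comm]
  linarith

/-- Given finitely many monotone functions on a well-quasi-order, any family of their values
attains its minimum. -/
theorem exists_forall_le_of_finite_of_monotone {I α β γ : Type*} [Nonempty I] [Preorder α]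
    [WellQuasiOrderedLE α] [LinearOrder γ] {F : Set β} (hF : F.Finite) {g : β → α → γ}
    (hg : ∀ b ∈ F, Monotone (g b)) {b : I → β} (hb : ∀ i, b i ∈ F) (a : I → α) :
    ∃ l, ∀ i, g (b l) (a l) ≤ g (b i) (a i) := by
  have hpwo : (Set.range fun i => g (b i) (a i)).IsPWO := by
    refine Set.IsPWO.mono (t := ⋃ x ∈ hF.toFinset, Set.range (g x)) ?_ ?_
    · refine (Finset.isPWO_bUnion _).2 fun x hx => ?_
      rw [← Set.image_univ]
      exact (Set.isPWO_of_wellQuasiOrderedLE _).image_of_monotone (hg x (hF.mem_toFinset.1 hx))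
    · rintro _ ⟨i, rfl⟩
      exact Set.mem_biUnion (hF.mem_toFinset.2 (hb i)) ⟨a i, rfl⟩
  obtain ⟨l, hl⟩ := hpwo.isWF.min_mem (Set.range_nonempty _)
  exact ⟨l, fun i => hl.trans_le (hpwo.isWF.min_le _ ⟨i, rfl⟩)⟩


/-- Numerical core of the proof of Lemma 3.1: with
`1/μ_i = 1 − (m Σ_k r′_k n′_{i,k})/(m′ Σ_j r_j n_{i,j})`, where `n_{i,j} ≥ −c` are integers
with `Σ_j r_j n_{i,j} < 0` and `n′_{i,k}` are nonnegative integers, every `μ_i` lies in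
`(0, 1]` and the supremum of the `μ_i` is attained by some index `l`. -/
theorem statement6 (s t : ℕ) (hs : 0 < s) (ht : 0 < t)
    (r : Fin s → ℝ) (hr : ∀ j, 0 < r j) (r' : Fin t → ℝ) (hr' : ∀ k, 0 < r' k)
    (m m' : ℕ) (hm : 0 < m) (hm' : 0 < m')
    (c : ℝ) (hc : 0 ≤ c)
    (I : Type*) [Nonempty I]
    (n : I → Fin s → ℤ) (hn1 : ∀ i j, -c ≤ (n i j : ℝ))
    (hn2 : ∀ i, ∑ j, r j * (n i j : ℝ) < 0)
    (n' : I → Fin t → ℕ)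
    (μ : I → ℝ)
    (hμ : ∀ i, (μ i)⁻¹ =
      1 - ((m : ℝ) * ∑ k, r' k * (n' i k : ℝ)) / ((m' : ℝ) * ∑ j, r j * (n i j : ℝ))) :
    (∀ i, 0 < μ i ∧ μ i ≤ 1) ∧ ∃ l : I, ∀ i : I, μ i ≤ μ l := by
  have hquot : ∀ i, ((m : ℝ) * ∑ k, r' k * (n' i k : ℝ)) /
      ((m' : ℝ) * ∑ j, r j * (n i j : ℝ)) ≤ 0 := fun i =>
    div_nonpos_of_nonneg_of_nonpos
      (mul_nonneg m.cast_nonneg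
        (Finset.sum_nonneg fun k _ => mul_nonneg (hr' k).le (Nat.cast_nonneg _)))
      (mul_nonpos_of_nonneg_of_nonpos m'.cast_nonneg (hn2 i).le)
  have hone : ∀ i, 1 ≤ (μ i)⁻¹ := fun i => by linarith [hμ i, hquot i]
  have hpos : ∀ i, 0 < μ i := fun i => inv_pos.1 (zero_lt_one.trans_le (hone i))
  refine ⟨fun i => ⟨hpos i, (one_le_inv₀ (hpos i)).1 (hone i)⟩, ?_⟩
  obtain ⟨l, hl⟩ := exists_forall_le_of_finite_of_monotone
    (finite_setOf_int_weighted_sum_nonpos hr c)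
    (g := fun v (w : Fin t → ℕ) => 1 - ((m : ℝ) * ∑ k, r' k * (w k : ℝ)) /
      ((m' : ℝ) * ∑ j, r j * (v j : ℝ)))
    (fun v hv w w' hw => sub_le_sub_left (div_le_div_of_nonpos_of_le
      (mul_nonpos_of_nonneg_of_nonpos m'.cast_nonneg hv.2)
      (mul_le_mul_of_nonneg_left (Finset.sum_le_sum fun k _ =>
        mul_le_mul_of_nonneg_left (Nat.cast_le.2 (Pi.le_def.1 hw k)) (hr' k).le) m.cast_nonneg)) 1)
    (fun i => ⟨hn1 i, (hn2 i).le⟩) n'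
  refine ⟨l, fun i => (inv_le_inv₀ (hpos l) (hpos i)).1 ?_⟩
  rw [hμ l, hμ i]
  exact hl i
end
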